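/- Let L/K be a cyclic Galois extension of degree n with Galois group generated by σ. Given a fixed normal element α of L/K, the map sending a unit u of the algebra K[x]/(x^n − 1) to u(σ)·α is a bijection from the unit group (K[x]/(x^n − 1))^× onto the set of all normal elements of L/K. -/

import Mathlib

/-- `α` is a normal element of `L/K` if its orbit under `Gal(L/K)` is a basis of `L`
as a `K`-vector space. -/
def IsNormalElement (K : Type*) {L : Type*} [Field K] [Field L] [Algebra K L] (α : L) : Prop :=
  LinearIndependent K (fun g : L ≃ₐ[K] L => g α) ∧
    Submodule.span K (Set.range fun g : L ≃ₐ[K] L => g α) = ⊤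

/-- For `u` in `K[x]/(x^n - 1)`, the endomorphism `u(σ)` of `L` obtained by evaluating
(a representative of) `u` at `σ`; when `σ ^ n = 1` this does not depend on the representative,
and it is the action of the group-algebra element corresponding to `u` under `σ ↦ x`. -/
noncomputable def evalAtGen {K L : Type*} [Field K] [Field L] [Algebra K L] (n : ℕ)
    (σ : L ≃ₐ[K] L)
    (u : Polynomial K ⧸ Ideal.span {(Polynomial.X ^ n - 1 : Polynomial K)}) :
    Module.End K L :=
  Polynomial.aeval (σ.toLinearMap : Module.End K L) (Quotient.out u)

open Polynomial in
/-- The `K`-algebra homomorphism `K[x]/(x^n - 1) → End_K(L)` sending `x` to `σ`. -/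
noncomputable def evalGenHom {K L : Type*} [Field K] [Field L] [Algebra K L] (n : ℕ)
    (σ : L ≃ₐ[K] L) (hσn : σ ^ n = 1) :
    (K[X] ⧸ Ideal.span {(X ^ n - 1 : K[X])}) →ₐ[K] Module.End K L :=
  Ideal.Quotient.liftₐ _ (aeval (σ.toLinearMap : Module.End K L)) (by
    intro a ha
    obtain ⟨q, rfl⟩ := Ideal.mem_span_singleton.mp ha
    have h : (σ.toLinearMap : Module.End K L) ^ n = 1 := by
      ext x
      rw [← AlgEquiv.pow_toLinearMap, hσn]
      rfl
    simp [h])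

section

variable {K L : Type*} [Field K] [Field L] [Algebra K L] {n : ℕ} {σ : L ≃ₐ[K] L}

open Polynomial

theorem evalGenHom_mk (hσn : σ ^ n = 1) (p : K[X]) :
    evalGenHom n σ hσn (Ideal.Quotient.mk _ p) = aeval (σ.toLinearMap : Module.End K L) p :=
  rfl

theorem evalAtGen_eq_evalGenHom (hσn : σ ^ n = 1)
    (u : K[X] ⧸ Ideal.span {(X ^ n - 1 : K[X])}) :
    evalAtGen n σ u = evalGenHom n σ hσn u := by
  conv_rhs => rw [← Ideal.Quotient.mk_out u]
  rfl

theorem toLinearMap_pow_apply (σ : L ≃ₐ[K] L) (k : ℕ) (x : L) :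
    ((σ.toLinearMap : Module.End K L) ^ k) x = (σ ^ k) x := by
  rw [← AlgEquiv.pow_toLinearMap]
  rfl

/-- The `K`-linear map `u ↦ u(σ) β`. -/
noncomputable def evalGenHomAt (hσn : σ ^ n = 1) (β : L) :
    (K[X] ⧸ Ideal.span {(X ^ n - 1 : K[X])}) →ₗ[K] L :=
  (LinearMap.applyₗ β).comp (evalGenHom n σ hσn).toLinearMap

theorem evalGenHomAt_apply (hσn : σ ^ n = 1) (β : L)
    (u : K[X] ⧸ Ideal.span {(X ^ n - 1 : K[X])}) :
    evalGenHomAt hσn β u = evalGenHom n σ hσn u β :=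
  rfl

theorem range_evalGenHomAt [FiniteDimensional K L] (hσn : σ ^ n = 1)
    (hσ : ∀ g : L ≃ₐ[K] L, g ∈ Subgroup.zpowers σ) (β : L) :
    LinearMap.range (evalGenHomAt hσn β) =
      Submodule.span K (Set.range fun g : L ≃ₐ[K] L => g β) := by
  apply le_antisymm
  · rintro _ ⟨u, rfl⟩
    obtain ⟨p, rfl⟩ := Ideal.Quotient.mk_surjective u
    rw [evalGenHomAt_apply, evalGenHom_mk, aeval_eq_sum_range, LinearMap.sum_apply]
    refine Submodule.sum_mem _ fun k _ => ?_
    rw [LinearMap.smul_apply, toLinearMap_pow_apply]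
    exact Submodule.smul_mem _ _ (Submodule.subset_span ⟨σ ^ k, rfl⟩)
  · rw [Submodule.span_le]
    rintro _ ⟨g, rfl⟩
    obtain ⟨k, rfl⟩ := mem_powers_iff_mem_zpowers.mpr (hσ g)
    refine ⟨Ideal.Quotient.mk _ (X ^ k), ?_⟩
    rw [evalGenHomAt_apply, evalGenHom_mk, map_pow, aeval_X, toLinearMap_pow_apply]

theorem isNormalElement_iff_surjective [FiniteDimensional K L] [IsGalois K L]
    (hσn : σ ^ n = 1) (hσ : ∀ g : L ≃ₐ[K] L, g ∈ Subgroup.zpowers σ) (β : L) :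
    IsNormalElement K β ↔ Function.Surjective (evalGenHomAt hσn β) := by
  rw [← LinearMap.range_eq_top, range_evalGenHomAt hσn hσ]
  refine ⟨And.right, fun h => ⟨?_, h⟩⟩
  exact linearIndependent_of_top_le_span_of_card_eq_finrank h.ge
    (by rw [← Nat.card_eq_fintype_card, IsGalois.card_aut_eq_finrank])

theorem injective_evalGenHomAt [FiniteDimensional K L] (hn : Module.finrank K L = n)
    (hσn : σ ^ n = 1) {β : L} (h : Function.Surjective (evalGenHomAt hσn β)) :
    Function.Injective (evalGenHomAt hσn β) := by
  have hpos : 0 < n := hn ▸ Module.finrank_pos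
  have hfin : Module.finrank K (K[X] ⧸ Ideal.span {(X ^ n - 1 : K[X])}) = n := by
    rw [finrank_quotient_span_eq_natDegree, ← C_1, natDegree_X_pow_sub_C]
  have : FiniteDimensional K (K[X] ⧸ Ideal.span {(X ^ n - 1 : K[X])}) :=
    Module.finite_of_finrank_pos (hpos.trans_eq hfin.symm)
  exact (LinearMap.injective_iff_surjective_of_finrank_eq_finrank (hfin.trans hn.symm)).mpr h

end

/-- For a cyclic Galois extension `L/K` of degree `n` with Galois group generated by `σ` and a
fixed normal element `α`, the map `u ↦ u(σ) α` is a bijection from the unit group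
`(K[x]/(x^n - 1))ˣ` onto the set of normal elements of `L/K`. -/
theorem units_equiv_normal_elements (K L : Type*) [Field K] [Field L] [Algebra K L]
    [FiniteDimensional K L] [IsGalois K L] (n : ℕ) (hn : Module.finrank K L = n)
    (σ : L ≃ₐ[K] L) (hσ : ∀ g : L ≃ₐ[K] L, g ∈ Subgroup.zpowers σ)
    (α : L) (hα : IsNormalElement K α) :
    Function.Injective
        (fun u : (Polynomial K ⧸ Ideal.span {(Polynomial.X ^ n - 1 : Polynomial K)})ˣ =>
          evalAtGen n σ (u : Polynomial K ⧸ Ideal.span {(Polynomial.X ^ n - 1 : Polynomial K)}) α) ∧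
      Set.range
        (fun u : (Polynomial K ⧸ Ideal.span {(Polynomial.X ^ n - 1 : Polynomial K)})ˣ =>
          evalAtGen n σ (u : Polynomial K ⧸ Ideal.span {(Polynomial.X ^ n - 1 : Polynomial K)}) α)
        = {β : L | IsNormalElement K β} := by
  have hσn : σ ^ n = 1 := by
    rw [← hn, ← IsGalois.card_aut_eq_finrank]
    exact pow_card_eq_one'
  have hsurj := (isNormalElement_iff_surjective hσn hσ α).mp hα
  have hinj := injective_evalGenHomAt hn hσn hsurj
  simp only [evalAtGen_eq_evalGenHom hσn]
  refine ⟨fun u v huv => Units.ext (hinj huv), ?_⟩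
  ext β
  rw [Set.mem_ofPred_eq, isNormalElement_iff_surjective hσn hσ]
  constructor
  · rintro ⟨u, rfl⟩ y
    obtain ⟨w, rfl⟩ := hsurj y
    refine ⟨w * ↑u⁻¹, ?_⟩
    simp only [evalGenHomAt_apply]
    rw [← Module.End.mul_apply, ← map_mul, Units.inv_mul_cancel_right]
  · intro hβ
    obtain ⟨u, rfl⟩ := hsurj β
    obtain ⟨v, hv⟩ := hβ α
    have hvu : v * u = 1 := hinj (by
      rw [evalGenHomAt_apply, map_mul, Module.End.mul_apply, evalGenHomAt_apply, map_one]
      exact hv)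
    exact ⟨⟨u, v, (mul_comm u v).trans hvu, hvu⟩, rfl⟩
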